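/- If M is a positive integer with M ≡ 1 (mod 8) and 5 | M, then 5·(1,8,8,0,0,0)(M/5²) = (1,10,10,0,0,0)(M) + 2·(4,5,6,0,4,0)(M) − 2·(2,5,10,0,0,0)(M), where (1,8,8,0,0,0)(M/5²) is understood to be 0 when 5² does not divide M. -/

import Mathlib

/-- The number of representations of `M` by the ternary quadratic form
`a x² + b y² + c z² + d y z + e z x + f x y`. -/
noncomputable def rep (a b c d e f M : ℤ) : ℕ :=
  {p : ℤ × ℤ × ℤ | M = a * p.1 ^ 2 + b * p.2.1 ^ 2 + c * p.2.2 ^ 2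
      + d * p.2.1 * p.2.2 + e * p.2.2 * p.1 + f * p.1 * p.2.1}.ncard

open Filter Topology


def TT (n : ℤ) : ℤ := n * (n - 1) / 2

lemma two_TT (n : ℤ) : 2 * TT n = n * (n - 1) := by
  unfold TT
  apply Int.mul_ediv_cancel'
  rcases Int.even_or_odd' n with ⟨k, rfl | rfl⟩
  · exact ⟨k * (2 * k - 1), by ring⟩
  · exact ⟨(2 * k + 1) * k, by ring⟩

lemma TT_succ (n : ℤ) : TT (n + 1) = TT n + n := by
  have h1 := two_TT n
  have h2 := two_TT (n + 1)
  have : 2 * TT (n + 1) = 2 * (TT n + n) := by rw [h2, mul_add, h1]; ring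
  omega

lemma TT_nonneg (n : ℤ) : 0 ≤ TT n := by
  have h1 := two_TT n
  have : 0 ≤ n * (n - 1) := by
    rcases le_or_gt n 0 with h | h
    · nlinarith
    · nlinarith
  omega

noncomputable def qp (a q : ℝ) : ℝ := ∏' n : ℕ, (1 - a * q ^ n)
noncomputable def th (z q : ℝ) : ℝ := ∑' n : ℤ, z ^ n * q ^ (TT n)

lemma summ_geo (a : ℝ) {q : ℝ} (h1 : |q| < 1) : Summable fun n : ℕ => ‖-(a * q ^ n)‖ := by
  simp only [norm_neg, norm_mul, norm_pow, Real.norm_eq_abs]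
  exact (summable_geometric_of_lt_one (abs_nonneg q) h1).mul_left _

lemma qp_tendsto (a : ℝ) {q : ℝ} (h1 : |q| < 1) :
    Tendsto (fun N => ∏ n ∈ Finset.range N, (1 - a * q ^ n)) atTop (𝓝 (qp a q)) := by
  have := (multipliable_one_add_of_summable (summ_geo a h1)).hasProd.tendsto_prod_nat
  simp only [← sub_eq_add_neg] at this
  exact this

lemma qp_ne_zero {a q : ℝ} (h1 : |q| < 1) (h : ∀ n : ℕ, 1 - a * q ^ n ≠ 0) : qp a q ≠ 0 := by
  have := tprod_one_add_ne_zero_of_summable (f := fun n : ℕ => -(a * q ^ n))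
    (by simpa only [← sub_eq_add_neg] using h) (summ_geo a h1)
  simp only [← sub_eq_add_neg] at this
  exact this

lemma one_sub_pow_ne {q : ℝ} (h1 : |q| < 1) (n : ℕ) : 1 - q ^ (n + 1) ≠ 0 := by
  have : |q ^ (n + 1)| < 1 := by
    rw [abs_pow]; exact pow_lt_one₀ (abs_nonneg _) h1 (by omega)
  have := (abs_lt.1 this).2
  linarith

lemma summ_nat {z q : ℝ} (hz : z ≠ 0) (h0 : q ≠ 0) (h1 : |q| < 1) :
    Summable fun n : ℕ => z ^ (n : ℤ) * q ^ (TT n) := by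
  apply summable_of_ratio_test_tendsto_lt_one (l := 0) one_pos
  · exact Eventually.of_forall fun n => mul_ne_zero (zpow_ne_zero _ hz) (zpow_ne_zero _ h0)
  · have : ∀ n : ℕ, ‖z ^ ((n + 1 : ℕ) : ℤ) * q ^ (TT (n + 1 : ℕ))‖ / ‖z ^ (n : ℤ) * q ^ (TT n)‖
        = |z| * |q| ^ n := by
      intro n
      rw [← norm_div]
      push_cast
      rw [TT_succ, zpow_add₀ hz, zpow_add₀ h0]
      have a1 := zpow_ne_zero (n : ℤ) hz
      have a2 := zpow_ne_zero (TT n) h0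
      rw [show z ^ (n : ℤ) * z ^ (1 : ℤ) * (q ^ TT n * q ^ (n : ℤ)) / (z ^ (n : ℤ) * q ^ TT n)
        = z * q ^ n by field_simp; simp]
      simp
    simp only [this]
    simpa using (tendsto_pow_atTop_nhds_zero_of_lt_one (abs_nonneg q) h1).const_mul |z|

lemma summ_th {z q : ℝ} (hz : z ≠ 0) (h0 : q ≠ 0) (h1 : |q| < 1) :
    Summable fun n : ℤ => z ^ n * q ^ (TT n) := by
  apply Summable.of_nat_of_neg
  · exact summ_nat hz h0 h1
  · have := summ_nat (z := q / z) (div_ne_zero h0 hz) h0 h1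
    refine this.congr fun n => ?_
    have : TT (-(n : ℤ)) = TT n + n := by
      have h1 := two_TT n
      have h2 := two_TT (-n)
      have : 2 * TT (-n) = 2 * (TT n + n) := by rw [h2, mul_add, h1]; ring
      omega
    rw [this, zpow_add₀ h0, div_zpow, zpow_neg]
    field_simp

lemma summ_th_norm {z q : ℝ} (hz : z ≠ 0) (h0 : q ≠ 0) (h1 : |q| < 1) :
    Summable fun n : ℤ => ‖z ^ n * q ^ (TT n)‖ := (summ_th hz h0 h1).norm

/-- finite q-Pochhammer -/
noncomputable def poc (q : ℝ) (N : ℕ) : ℝ := ∏ n ∈ Finset.range N, (1 - q ^ (n + 1))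

noncomputable def upoc (q : ℝ) (k : ℤ) : ℝ := if k < 0 then 0 else (poc q k.toNat)⁻¹

lemma poc_ne {q : ℝ} (h1 : |q| < 1) (N : ℕ) : poc q N ≠ 0 :=
  Finset.prod_ne_zero_iff.2 fun n _ => one_sub_pow_ne h1 n

lemma poc_succ (q : ℝ) (N : ℕ) : poc q (N + 1) = poc q N * (1 - q ^ (N + 1)) :=
  Finset.prod_range_succ _ _

lemma upoc_rec {q : ℝ} (h1 : |q| < 1) (k : ℤ) : upoc q (k - 1) = (1 - q ^ k) * upoc q k := by
  rcases lt_trichotomy k 0 with h | rfl | h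
  · simp [upoc, h, show k < 1 by omega]
  · simp [upoc]
  · obtain ⟨n, rfl⟩ : ∃ n : ℕ, k = n + 1 := ⟨(k - 1).toNat, by omega⟩
    have e1 : ¬ ((n : ℤ) < 0) := by omega
    have e2 : ¬ ((n : ℤ) + 1 < 0) := by omega
    have e3 : ((n : ℤ) + 1).toNat = n + 1 := by omega
    simp only [upoc, add_sub_cancel_right, e1, e2, if_false, e3, Int.toNat_natCast, poc_succ]
    have a1 := poc_ne h1 n
    have a2 := one_sub_pow_ne h1 n
    have e4 : q ^ ((n : ℤ) + 1) = q ^ (n + 1) := by exact_mod_cast zpow_natCast q (n + 1)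
    rw [e4]
    field_simp

noncomputable def cc (q : ℝ) (N : ℕ) (n : ℤ) : ℝ := poc q (2 * N) * upoc q (N + n) * upoc q (N - n)

lemma cc_rec {q : ℝ} (h0 : q ≠ 0) (h1 : |q| < 1) (N : ℕ) (n : ℤ) :
    cc q (N + 1) n = (1 + q ^ (2 * N + 1)) * cc q N n + q ^ ((N : ℤ) + 1 - n) * cc q N (n - 1)
      + q ^ ((N : ℤ) + 1 + n) * cc q N (n + 1) := by
  unfold cc
  have e1 : upoc q (N + n) = (1 - q ^ ((N : ℤ) + 1 + n)) * upoc q (N + 1 + n) := by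
    rw [← upoc_rec h1]; congr 1; ring
  have e2 : upoc q (N - n) = (1 - q ^ ((N : ℤ) + 1 - n)) * upoc q (N + 1 - n) := by
    rw [← upoc_rec h1]; congr 1; ring
  have e3 : upoc q (N + (n - 1)) = (1 - q ^ ((N : ℤ) + n)) * upoc q (N + n) := by
    rw [← upoc_rec h1]; congr 1; ring
  have e4 : upoc q (N - (n + 1)) = (1 - q ^ ((N : ℤ) - n)) * upoc q (N - n) := by
    rw [← upoc_rec h1]; congr 1; ring
  have e5 : upoc q (N - (n - 1)) = upoc q (N + 1 - n) := by congr 1; ring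
  have e6 : upoc q (N + (n + 1)) = upoc q (N + 1 + n) := by congr 1; ring
  have x1 : q ^ ((N : ℤ) + 1 + n) = q ^ N * q * q ^ n := by
    rw [zpow_add₀ h0, zpow_add₀ h0]; simp
  have x2 : q ^ ((N : ℤ) + 1 - n) = q ^ N * q * (q ^ n)⁻¹ := by
    rw [zpow_sub₀ h0, zpow_add₀ h0]; simp [div_eq_mul_inv]
  have x3 : q ^ ((N : ℤ) + n) = q ^ N * q ^ n := by
    rw [zpow_add₀ h0]; simp
  have x4 : q ^ ((N : ℤ) - n) = q ^ N * (q ^ n)⁻¹ := by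
    rw [zpow_sub₀ h0]; simp [div_eq_mul_inv]
  rw [e3, e4, e5, e6, e1, e2, x1, x2, x3, x4, show 2 * (N + 1) = 2 * N + 1 + 1 by ring, poc_succ, poc_succ]
  push_cast
  have := zpow_ne_zero n h0
  field_simp
  ring

lemma cc_zero (q : ℝ) (n : ℤ) : cc q 0 n = if n = 0 then 1 else 0 := by
  unfold cc upoc
  rcases lt_trichotomy n 0 with h | rfl | h
  · simp [h, h.ne]
  · simp [poc]
  · simp [h, h.ne']

lemma finite_jtp {z q : ℝ} (hz : z ≠ 0) (h0 : q ≠ 0) (h1 : |q| < 1) (N : ℕ) :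
    HasSum (fun n : ℤ => cc q N n * (z ^ n * q ^ (TT n)))
      ((∏ n ∈ Finset.range N, (1 - -z * q ^ n)) * ∏ n ∈ Finset.range N, (1 - -(q / z) * q ^ n)) := by
  induction N with
  | zero =>
    simp only [cc_zero, Finset.range_zero, Finset.prod_empty]
    have := hasSum_ite_eq (0 : ℤ) (1 : ℝ)
    rw [mul_one]
    convert! this using 2 with n
    split_ifs with h
    · subst h; simp [TT]
    · simp
  | succ N ih =>
    rw [Finset.prod_range_succ, Finset.prod_range_succ]
    have s1 := ih.mul_left (1 + q ^ (2 * N + 1))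
    have s2 := ((Equiv.subRight (1 : ℤ)).hasSum_iff.2 ih).mul_left (z * q ^ N)
    have s3 := ((Equiv.addRight (1 : ℤ)).hasSum_iff.2 ih).mul_left (z⁻¹ * q ^ (N + 1))
    have s := (s1.add s2).add s3
    convert! s using 1
    · funext n
      simp only [Function.comp, Equiv.subRight_apply, Equiv.coe_addRight]
      rw [cc_rec h0 h1, TT_succ]
      have t : TT (n - 1) = TT n - n + 1 := by
        have := TT_succ (n - 1); rw [sub_add_cancel] at this; omega
      rw [t, zpow_add₀ h0, zpow_add₀ h0, zpow_add₀ h0, zpow_add₀ h0, zpow_sub₀ h0, zpow_sub₀ h0, zpow_sub₀ hz,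
        zpow_add₀ hz, zpow_add₀ h0]
      have := zpow_ne_zero n h0
      simp only [zpow_natCast, zpow_one]
      field_simp
      ring
    · field_simp
      ring

lemma poc_tendsto {q : ℝ} (h1 : |q| < 1) : Tendsto (poc q) atTop (𝓝 (qp q q)) := by
  have := qp_tendsto q h1
  refine this.congr fun N => ?_
  unfold poc
  exact Finset.prod_congr rfl fun n _ => by ring

lemma ff_ne {q : ℝ} (h1 : |q| < 1) : qp q q ≠ 0 :=
  qp_ne_zero h1 fun n => by
    have := one_sub_pow_ne h1 n
    rwa [show q * q ^ n = q ^ (n + 1) by ring]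

lemma upoc_tendsto {q : ℝ} (h1 : |q| < 1) : Tendsto (upoc q) atTop (𝓝 (qp q q)⁻¹) := by
  have h : Tendsto (fun k : ℤ => (poc q k.toNat)⁻¹) atTop (𝓝 (qp q q)⁻¹) :=
    ((poc_tendsto h1).comp (tendsto_atTop.2 fun b => by
      filter_upwards [eventually_ge_atTop (b : ℤ)] with k hk; omega)).inv₀ (ff_ne h1)
  refine h.congr' ?_
  filter_upwards [eventually_ge_atTop 0] with k hk
  simp [upoc, not_lt.2 hk]

lemma upoc_bdd {q : ℝ} (h1 : |q| < 1) : ∃ C, ∀ k, |upoc q k| ≤ C := by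
  have h : Tendsto (fun k : ℕ => (poc q k)⁻¹) atTop (𝓝 (qp q q)⁻¹) :=
    (poc_tendsto h1).inv₀ (ff_ne h1)
  obtain ⟨C, hC⟩ := (Metric.isBounded_range_of_tendsto _ h).exists_norm_le
  refine ⟨max C 0, fun k => ?_⟩
  unfold upoc
  split_ifs
  · simp
  · exact (hC _ ⟨_, rfl⟩).trans (le_max_left _ _)

lemma poc_bdd {q : ℝ} (h1 : |q| < 1) : ∃ C, ∀ k, |poc q k| ≤ C := by
  obtain ⟨C, hC⟩ := (Metric.isBounded_range_of_tendsto _ (poc_tendsto h1)).exists_norm_le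
  exact ⟨C, fun k => hC _ ⟨_, rfl⟩⟩

theorem jtp {z q : ℝ} (hz : z ≠ 0) (h0 : q ≠ 0) (h1 : |q| < 1) :
    th z q = qp q q * qp (-z) q * qp (-(q / z)) q := by
  have L1 : Tendsto (fun N => ∑' n : ℤ, cc q N n * (z ^ n * q ^ (TT n))) atTop
      (𝓝 (qp (-z) q * qp (-(q / z)) q)) := by
    refine ((qp_tendsto (-z) h1).mul (qp_tendsto (-(q / z)) h1)).congr fun N => ?_
    exact (finite_jtp hz h0 h1 N).tsum_eq.symm
  obtain ⟨C, hC⟩ := upoc_bdd h1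
  obtain ⟨B, hB⟩ := poc_bdd h1
  have L2 : Tendsto (fun N => ∑' n : ℤ, cc q N n * (z ^ n * q ^ (TT n))) atTop
      (𝓝 (∑' n : ℤ, (qp q q)⁻¹ * (z ^ n * q ^ (TT n)))) := by
    apply tendsto_tsum_of_dominated_convergence (bound := fun n => B * C * C * ‖z ^ n * q ^ (TT n)‖)
    · exact (summ_th_norm hz h0 h1).mul_left _
    · intro n
      apply Tendsto.mul_const
      have a1 : Tendsto (fun N : ℕ => poc q (2 * N)) atTop (𝓝 (qp q q)) :=
        (poc_tendsto h1).comp (tendsto_id.const_mul_atTop' (by norm_num))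
      have a2 : Tendsto (fun N : ℕ => upoc q (N + n)) atTop (𝓝 (qp q q)⁻¹) :=
        (upoc_tendsto h1).comp (tendsto_atTop_add_const_right _ _ tendsto_natCast_atTop_atTop)
      have a3 : Tendsto (fun N : ℕ => upoc q (N - n)) atTop (𝓝 (qp q q)⁻¹) :=
        (upoc_tendsto h1).comp (tendsto_atTop_add_const_right _ _ tendsto_natCast_atTop_atTop)
      have := (a1.mul a2).mul a3
      rwa [mul_inv_cancel₀ (ff_ne h1), one_mul] at this
    · refine Eventually.of_forall fun N n => ?_
      rw [norm_mul]
      apply mul_le_mul_of_nonneg_right _ (norm_nonneg _)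
      unfold cc
      rw [norm_mul, norm_mul]
      have hB0 : 0 ≤ B := (abs_nonneg _).trans (hB 0)
      have hC0 : 0 ≤ C := (abs_nonneg _).trans (hC 0)
      simp only [Real.norm_eq_abs]
      gcongr
      · exact hB _
      · exact hC _
      · exact hC _
  have := tendsto_nhds_unique L1 L2
  rw [tsum_mul_left] at this
  unfold th
  rw [mul_assoc, this, mul_inv_cancel_left₀ (ff_ne h1)]



noncomputable def ff (q : ℝ) : ℝ := qp q q
noncomputable def phi (q : ℝ) : ℝ := ∑' n : ℤ, q ^ (n ^ 2)
noncomputable def Psi (q : ℝ) : ℝ := ∑' n : ℤ, q ^ (TT n)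

lemma abs_pow_lt {q : ℝ} (h1 : |q| < 1) {k : ℕ} (hk : k ≠ 0) : |q ^ k| < 1 := by
  rw [abs_pow]; exact pow_lt_one₀ (abs_nonneg _) h1 hk

lemma prod_range_mul_aux (g : ℕ → ℝ) (k N : ℕ) :
    ∏ n ∈ Finset.range (k * N), g n
      = ∏ j ∈ Finset.range k, ∏ n ∈ Finset.range N, g (j + k * n) := by
  induction N with
  | zero => simp
  | succ N ih =>
    rw [Nat.mul_succ, Finset.prod_range_add, ih, ← Finset.prod_mul_distrib]
    refine Finset.prod_congr rfl fun j _ => ?_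
    rw [Finset.prod_range_succ, add_comm j]

lemma qp_split (a : ℝ) {q : ℝ} (h1 : |q| < 1) {k : ℕ} (hk : k ≠ 0) :
    qp a q = ∏ j ∈ Finset.range k, qp (a * q ^ j) (q ^ k) := by
  have L1 : Tendsto (fun N => ∏ n ∈ Finset.range (k * N), (1 - a * q ^ n)) atTop (𝓝 (qp a q)) :=
    (qp_tendsto a h1).comp (tendsto_id.const_mul_atTop' (by omega))
  have L2 : Tendsto (fun N => ∏ j ∈ Finset.range k, ∏ n ∈ Finset.range N,
      (1 - (a * q ^ j) * (q ^ k) ^ n)) atTop (𝓝 (∏ j ∈ Finset.range k, qp (a * q ^ j) (q ^ k))) :=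
    tendsto_finsetProd _ fun j _ => qp_tendsto (a * q ^ j) (abs_pow_lt h1 hk)
  refine tendsto_nhds_unique L1 (L2.congr fun N => ?_)
  rw [prod_range_mul_aux]
  refine Finset.prod_congr rfl fun j _ => Finset.prod_congr rfl fun n _ => ?_
  rw [pow_add, pow_mul]; ring

lemma qp_mul_neg (a : ℝ) {q : ℝ} (h1 : |q| < 1) : qp a q * qp (-a) q = qp (a ^ 2) (q ^ 2) := by
  refine tendsto_nhds_unique ((qp_tendsto a h1).mul (qp_tendsto (-a) h1))
    ((qp_tendsto (a ^ 2) (abs_pow_lt h1 two_ne_zero)).congr fun N => ?_)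
  rw [← Finset.prod_mul_distrib]
  refine Finset.prod_congr rfl fun n _ => ?_
  ring

lemma ff_ne_zero {q : ℝ} (h1 : |q| < 1) : ff q ≠ 0 := ff_ne h1

lemma ff_split2 {q : ℝ} (h1 : |q| < 1) : ff q = qp q (q ^ 2) * ff (q ^ 2) := by
  unfold ff
  rw [qp_split q h1 two_ne_zero]
  simp only [Finset.prod_range_succ, Finset.prod_range_zero, one_mul, pow_zero, mul_one, pow_one]
  rw [show q * q = q ^ 2 by ring]

/-- the odd product -/
lemma odd_prod {q : ℝ} (h1 : |q| < 1) :
    qp (-q) (q ^ 2) * ff q * ff (q ^ 4) = ff (q ^ 2) ^ 2 := by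
  have e1 := ff_split2 h1
  have e2 := ff_split2 (abs_pow_lt h1 two_ne_zero)
  have e3 := qp_mul_neg q (abs_pow_lt h1 two_ne_zero)
  rw [show (q ^ 2) ^ 2 = q ^ 4 by ring] at e2 e3
  calc _ = (qp q (q ^ 2) * qp (-q) (q ^ 2)) * ff (q ^ 4) * ff (q ^ 2) := by rw [e1]; ring
    _ = _ := by rw [e3, ← e2]; ring

lemma even_prod {q : ℝ} (h1 : |q| < 1) : qp (-q) q * ff q = ff (q ^ 2) := by
  unfold ff
  rw [mul_comm, qp_mul_neg q h1]

lemma ff_neg {q : ℝ} (h1 : |q| < 1) : ff (-q) * ff q * ff (q ^ 4) = ff (q ^ 2) ^ 3 := by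
  have e := ff_split2 (q := -q) (by rwa [abs_neg])
  rw [neg_sq] at e
  rw [e, pow_succ _ 2, ← odd_prod h1]; ring

lemma phi_eq {q : ℝ} (h0 : q ≠ 0) : phi q = th q (q ^ 2) := by
  unfold phi th
  congr 1; funext n
  rw [← zpow_natCast, ← zpow_mul, ← zpow_add₀ h0]
  congr 1
  push_cast
  rw [two_TT]; ring

lemma phi_summ {q : ℝ} (h0 : q ≠ 0) (h1 : |q| < 1) : Summable fun n : ℤ => ‖q ^ (n ^ 2)‖ := by
  refine (summ_th_norm h0 (pow_ne_zero 2 h0) (abs_pow_lt h1 two_ne_zero)).congr fun n => ?_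
  rw [← zpow_natCast, ← zpow_mul, ← zpow_add₀ h0]
  congr 2
  push_cast
  rw [two_TT]; ring

lemma Psi_eq (q : ℝ) : Psi q = th 1 q := by
  unfold Psi th
  simp

lemma Psi_summ {q : ℝ} (h0 : q ≠ 0) (h1 : |q| < 1) : Summable fun n : ℤ => ‖q ^ (TT n)‖ := by
  simpa using summ_th_norm one_ne_zero h0 h1

lemma phi_qp {q : ℝ} (h0 : q ≠ 0) (h1 : |q| < 1) : phi q = ff (q ^ 2) * qp (-q) (q ^ 2) ^ 2 := by
  rw [phi_eq h0, jtp h0 (pow_ne_zero 2 h0) (abs_pow_lt h1 two_ne_zero),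
    show q ^ 2 / q = q by field_simp]
  unfold ff; ring

lemma phi_prod {q : ℝ} (h0 : q ≠ 0) (h1 : |q| < 1) :
    phi q * ff q ^ 2 * ff (q ^ 4) ^ 2 = ff (q ^ 2) ^ 5 := by
  rw [phi_qp h0 h1]
  linear_combination (ff (q ^ 2)) * (qp (-q) (q ^ 2) * ff q * ff (q ^ 4) + ff (q ^ 2) ^ 2) * odd_prod h1

lemma phi_neg_prod {q : ℝ} (h0 : q ≠ 0) (h1 : |q| < 1) : phi (-q) * ff (q ^ 2) = ff q ^ 2 := by
  rw [phi_qp (neg_ne_zero.2 h0) (by rwa [abs_neg]), ff_split2 h1]; simp; ring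

lemma Psi_prod {q : ℝ} (h0 : q ≠ 0) (h1 : |q| < 1) : Psi q * ff q = 2 * ff (q ^ 2) ^ 2 := by
  rw [Psi_eq, jtp one_ne_zero h0 h1, ← even_prod h1, div_one]
  have : qp (-1) q = 2 * qp (-q) q := by
    have L1 := (tendsto_add_atTop_iff_nat 1).2 (qp_tendsto (-1) h1)
    have L2 := (qp_tendsto (-q) h1).const_mul 2
    refine tendsto_nhds_unique L1 (L2.congr fun N => ?_)
    rw [Finset.prod_range_succ', mul_comm]
    congr 1
    · exact Finset.prod_congr rfl fun n _ => by ring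
    · norm_num
  rw [this]; unfold ff; ring

lemma pent {q : ℝ} (h0 : q ≠ 0) (h1 : |q| < 1) : th (-q) (q ^ 3) = ff q := by
  rw [jtp (neg_ne_zero.2 h0) (pow_ne_zero 3 h0) (abs_pow_lt h1 three_ne_zero)]
  unfold ff
  rw [qp_split q h1 three_ne_zero]
  simp only [Finset.prod_range_succ, Finset.prod_range_zero, one_mul, pow_zero, mul_one, pow_one]
  rw [show -(q ^ 3 / -q) = q * q by field_simp, neg_neg, show q * q ^ 2 = q ^ 3 by ring]
  ring

lemma R5a_prod {q : ℝ} (h0 : q ≠ 0) (h1 : |q| < 1) :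
    th q (q ^ 10) * th (q ^ 3) (q ^ 10) * (ff q * ff (q ^ 4))
      = ff (q ^ 2) ^ 2 * ff (q ^ 5) * ff (q ^ 20) := by
  have h10 := abs_pow_lt h1 (show 10 ≠ 0 by norm_num)
  have h5 := abs_pow_lt h1 (show 5 ≠ 0 by norm_num)
  rw [jtp h0 (pow_ne_zero 10 h0) h10, jtp (pow_ne_zero 3 h0) (pow_ne_zero 10 h0) h10,
    show q ^ 10 / q = q ^ 9 by field_simp, show q ^ 10 / q ^ 3 = q ^ 7 by field_simp]
  have e := qp_split (-q) (abs_pow_lt h1 two_ne_zero) (show 5 ≠ 0 by norm_num)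
  simp only [Finset.prod_range_succ, Finset.prod_range_zero, one_mul, pow_zero, mul_one, pow_one,
    ← pow_mul, Nat.reduceMul, neg_mul, ← pow_succ', Nat.reduceAdd] at e
  have o1 := odd_prod h1
  have o5 := odd_prod h5
  simp only [← pow_mul, Nat.reduceMul] at o5
  have hf := ff_ne_zero h10
  rw [e] at o1
  rw [show qp (q ^ 10) (q ^ 10) = ff (q ^ 10) from rfl]
  apply mul_left_cancel₀ (pow_ne_zero 2 hf)
  generalize ff (q ^ 10) = f10 at *
  rw [← o1]
  conv_lhs => rw [← o5]
  ring

lemma R5b_prod {q : ℝ} (h0 : q ≠ 0) (h1 : |q| < 1) :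
    th q (q ^ 5) * th (q ^ 2) (q ^ 5) * (ff q * ff (q ^ 10))
      = ff (q ^ 2) * ff (q ^ 5) ^ 3 := by
  have h5 := abs_pow_lt h1 (show 5 ≠ 0 by norm_num)
  rw [jtp h0 (pow_ne_zero 5 h0) h5, jtp (pow_ne_zero 2 h0) (pow_ne_zero 5 h0) h5,
    show q ^ 5 / q = q ^ 4 by field_simp, show q ^ 5 / q ^ 2 = q ^ 3 by field_simp]
  have e := qp_split (-q) h1 (show 5 ≠ 0 by norm_num)
  simp only [Finset.prod_range_succ, Finset.prod_range_zero, one_mul, pow_zero, mul_one, pow_one,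
    ← pow_mul, Nat.reduceMul, neg_mul, ← pow_succ', Nat.reduceAdd] at e
  have o1 := even_prod h1
  have o5 := even_prod h5
  simp only [← pow_mul, Nat.reduceMul] at o5
  rw [e] at o1
  rw [show qp (q ^ 5) (q ^ 5) = ff (q ^ 5) from rfl, ← o1, ← o5]
  ring

lemma tsum_classes {α β : Type*} {k : ℕ} (e : Fin k → α → β)
    (he : Function.Bijective (fun p : Fin k × α => e p.1 p.2)) (F : β → ℝ) (hF : Summable F) :
    ∑' p, F p = ∑ j, ∑' p, F (e j p) := by
  have h2 : Summable (fun p : Fin k × α => F (e p.1 p.2)) :=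
    (Equiv.ofBijective _ he).summable_iff.2 hF
  rw [← (Equiv.ofBijective _ he).tsum_eq F]
  exact Eq.trans h2.tsum_prod (tsum_fintype _)

def e5 : Fin 5 → ℤ × ℤ → ℤ × ℤ
  | 0, (a, b) => (2 * a - b, a + 2 * b)
  | 1, (a, b) => (-2 * a - b + 1, -a + 2 * b)
  | 2, (a, b) => (2 * a + b - 1, a - 2 * b)
  | 3, (a, b) => (a - 2 * b, -2 * a - b + 1)
  | 4, (a, b) => (-a + 2 * b, 2 * a + b - 1)

lemma e5_bij : Function.Bijective (fun p : Fin 5 × (ℤ × ℤ) => e5 p.1 p.2) := by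
  constructor
  · rintro ⟨i, a, b⟩ ⟨j, c, d⟩ h
    fin_cases i <;> fin_cases j <;> simp [e5] at h ⊢ <;> omega
  · rintro ⟨x, y⟩
    have : (x - 2 * y) % 5 = 0 ∨ (x - 2 * y) % 5 = 1 ∨ (x - 2 * y) % 5 = 4 ∨ (x - 2 * y) % 5 = 3
      ∨ (x - 2 * y) % 5 = 2 := by omega
    rcases this with h | h | h | h | h
    · exact ⟨(0, (2 * x + y) / 5, (2 * y - x) / 5), by simp [e5]; omega⟩
    · exact ⟨(1, (2 - 2 * x - y) / 5, (2 * y - x + 1) / 5), by simp [e5]; omega⟩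
    · exact ⟨(2, (2 + 2 * x + y) / 5, (x - 2 * y + 1) / 5), by simp [e5]; omega⟩
    · exact ⟨(3, (x - 2 * y + 2) / 5, (1 - 2 * x - y) / 5), by simp [e5]; omega⟩
    · exact ⟨(4, (2 - x + 2 * y) / 5, (1 + 2 * x + y) / 5), by simp [e5]; omega⟩

def g5 : Fin 5 → ℤ × ℤ → ℤ × ℤ
  | 0, (a, b) => (2 * a - b, a + 2 * b - 1)
  | 1, (a, b) => (2 * a - b, a + 2 * b)
  | 2, (a, b) => (1 - (2 * a - b), 1 - (a + 2 * b))
  | 3, (a, b) => (1 - (a + 2 * b), 2 * a - b)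
  | 4, (a, b) => (a + 2 * b, 1 - (2 * a - b))

lemma g5_bij : Function.Bijective (fun p : Fin 5 × (ℤ × ℤ) => g5 p.1 p.2) := by
  constructor
  · rintro ⟨i, a, b⟩ ⟨j, c, d⟩ h
    fin_cases i <;> fin_cases j <;> simp [g5] at h ⊢ <;> omega
  · rintro ⟨x, y⟩
    have : (x - 2 * y) % 5 = 2 ∨ (x - 2 * y) % 5 = 0 ∨ (x - 2 * y) % 5 = 4 ∨ (x - 2 * y) % 5 = 1
      ∨ (x - 2 * y) % 5 = 3 := by omega
    rcases this with h | h | h | h | h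
    · exact ⟨(0, (2 * x + y + 1) / 5, (2 * y + 2 - x) / 5), by simp [g5]; omega⟩
    · exact ⟨(1, (2 * x + y) / 5, (2 * y - x) / 5), by simp [g5]; omega⟩
    · exact ⟨(2, (2 * (1 - x) + (1 - y)) / 5, (2 * (1 - y) - (1 - x)) / 5), by simp [g5]; omega⟩
    · exact ⟨(3, (2 * y + (1 - x)) / 5, (2 * (1 - x) - y) / 5), by simp [g5]; omega⟩
    · exact ⟨(4, (2 * (1 - y) + x) / 5, (2 * x - (1 - y)) / 5), by simp [g5]; omega⟩

lemma prod_sum {f g : ℤ → ℝ} (hf : Summable fun n => ‖f n‖) (hg : Summable fun n => ‖g n‖) :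
    ((∑' n, f n) * ∑' n, g n) = ∑' p : ℤ × ℤ, f p.1 * g p.2 := tsum_mul_tsum_of_summable_norm hf hg

lemma L1 {q : ℝ} (h0 : q ≠ 0) (h1 : |q| < 1) :
    phi q ^ 2 - phi (q ^ 5) ^ 2 = 4 * q * (th q (q ^ 10) * th (q ^ 3) (q ^ 10)) := by
  have h10 := abs_pow_lt h1 (show 10 ≠ 0 by norm_num)
  have h5 := abs_pow_lt h1 (show 5 ≠ 0 by norm_num)
  have s1 := phi_summ h0 h1
  have s5 := phi_summ (pow_ne_zero 5 h0) h5
  have t1 := summ_th_norm h0 (pow_ne_zero 10 h0) h10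
  have t2 := summ_th_norm (pow_ne_zero 3 h0) (pow_ne_zero 10 h0) h10
  rw [pow_two, pow_two]
  unfold phi th
  rw [prod_sum s1 s1, prod_sum s5 s5, prod_sum t1 t2,
    tsum_classes e5 e5_bij _ (summable_mul_of_summable_norm s1 s1), Fin.sum_univ_five]
  have c0 : ∀ p : ℤ × ℤ, q ^ (e5 0 p).1 ^ 2 * q ^ (e5 0 p).2 ^ 2
      = (q ^ 5) ^ p.1 ^ 2 * (q ^ 5) ^ p.2 ^ 2 := by
    rintro ⟨a, b⟩
    simp only [e5, ← zpow_natCast q, ← zpow_mul, ← zpow_add₀ h0]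
    congr 1; push_cast; ring
  have key : ∀ p : ℤ × ℤ, ∀ x y : ℤ, x ^ 2 + y ^ 2 = 5 * p.1 ^ 2 - 4 * p.1 + 5 * p.2 ^ 2 - 2 * p.2 + 1 →
      q ^ x ^ 2 * q ^ y ^ 2 = q ^ (1:ℤ) * (q ^ p.1 * (q ^ 10) ^ (TT p.1) * ((q ^ 3) ^ p.2 * (q ^ 10) ^ (TT p.2))) := by
    rintro ⟨a, b⟩ x y h
    simp only [← zpow_natCast q, ← zpow_mul, ← zpow_add₀ h0]
    congr 1; push_cast
    simp only at h
    linear_combination h - 5 * two_TT a - 5 * two_TT b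
  rw [tsum_congr c0, tsum_congr fun p : ℤ × ℤ => key p _ _ (by simp only [e5]; ring),
    tsum_congr fun p : ℤ × ℤ => key p (e5 2 p).1 (e5 2 p).2 (by simp only [e5]; ring),
    tsum_congr fun p : ℤ × ℤ => key p (e5 3 p).1 (e5 3 p).2 (by simp only [e5]; ring),
    tsum_congr fun p : ℤ × ℤ => key p (e5 4 p).1 (e5 4 p).2 (by simp only [e5]; ring), tsum_mul_left, zpow_one]
  ring

lemma L2 {q : ℝ} (h0 : q ≠ 0) (h1 : |q| < 1) :
    Psi q ^ 2 - q * Psi (q ^ 5) ^ 2 = 4 * (th q (q ^ 5) * th (q ^ 2) (q ^ 5)) := by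
  have h5 := abs_pow_lt h1 (show 5 ≠ 0 by norm_num)
  have s1 := Psi_summ h0 h1
  have s5 := Psi_summ (pow_ne_zero 5 h0) h5
  have t1 := summ_th_norm h0 (pow_ne_zero 5 h0) h5
  have t2 := summ_th_norm (pow_ne_zero 2 h0) (pow_ne_zero 5 h0) h5
  rw [pow_two, pow_two]
  unfold Psi th
  rw [prod_sum s1 s1, prod_sum s5 s5, prod_sum t1 t2,
    tsum_classes g5 g5_bij _ (summable_mul_of_summable_norm s1 s1), Fin.sum_univ_five]
  have c0 : ∀ p : ℤ × ℤ, q ^ TT (g5 0 p).1 * q ^ TT (g5 0 p).2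
      = q ^ (1:ℤ) * ((q ^ 5) ^ TT p.1 * (q ^ 5) ^ TT p.2) := by
    rintro ⟨a, b⟩
    simp only [g5, ← zpow_natCast q, ← zpow_mul, ← zpow_add₀ h0]
    congr 1; push_cast
    apply mul_left_cancel₀ (two_ne_zero (α := ℤ))
    linear_combination two_TT (2 * a - b) + two_TT (a + 2 * b - 1) - 5 * two_TT a - 5 * two_TT b
  have key : ∀ p : ℤ × ℤ, ∀ x y : ℤ,
      x * (x - 1) + y * (y - 1) = 5 * p.1 ^ 2 - 3 * p.1 + 5 * p.2 ^ 2 - p.2 →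
      q ^ TT x * q ^ TT y = (q ^ p.1 * (q ^ 5) ^ (TT p.1) * ((q ^ 2) ^ p.2 * (q ^ 5) ^ (TT p.2))) := by
    rintro ⟨a, b⟩ x y h
    simp only [← zpow_natCast q, ← zpow_mul, ← zpow_add₀ h0]
    congr 1; push_cast
    simp only at h
    apply mul_left_cancel₀ (two_ne_zero (α := ℤ))
    linear_combination h + two_TT x + two_TT y - 5 * two_TT a - 5 * two_TT b
  rw [tsum_congr c0, tsum_congr fun p : ℤ × ℤ => key p _ _ (by simp only [g5]; ring),
    tsum_congr fun p : ℤ × ℤ => key p (g5 2 p).1 (g5 2 p).2 (by simp only [g5]; ring),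
    tsum_congr fun p : ℤ × ℤ => key p (g5 3 p).1 (g5 3 p).2 (by simp only [g5]; ring),
    tsum_congr fun p : ℤ × ℤ => key p (g5 4 p).1 (g5 4 p).2 (by simp only [g5]; ring), tsum_mul_left, zpow_one]
  ring


lemma pm_congr (a b c : ℤ) (h : a = b + 2 * c) : (-1 : ℝ) ^ a = (-1) ^ b := by
  rw [h, zpow_add₀ (by norm_num), zpow_mul]; norm_num

lemma pm_sq (a : ℤ) : (-1 : ℝ) ^ (a ^ 2) = (-1) ^ a := by
  have := two_TT a
  exact pm_congr _ _ (TT a) (by rw [this]; ring)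

lemma neg_zpow_eq (x : ℝ) (n : ℤ) : (-x) ^ n = (-1) ^ n * x ^ n := by
  rw [neg_eq_neg_one_mul, mul_zpow]

def h4 : Fin 4 → ℤ × ℤ → ℤ × ℤ
  | 0, (a, b) => (2 * a + b, b)
  | 1, (a, b) => (1 - a - 5 * b, -a + b)
  | 2, (a, b) => (a + 5 * b - 1, a - b)
  | 3, (a, b) => (a + 5 * b + 3, a - b)

lemma h4_bij : Function.Bijective (fun p : Fin 4 × (ℤ × ℤ) => h4 p.1 p.2) := by
  constructor
  · rintro ⟨i, a, b⟩ ⟨j, c, d⟩ h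
    fin_cases i <;> fin_cases j <;> simp [h4] at h ⊢ <;> omega
  · rintro ⟨x, y⟩
    have : (x - y) % 2 = 0 ∨ (x - y) % 6 = 1 ∨ (x - y) % 6 = 5 ∨ (x - y) % 6 = 3 := by omega
    rcases this with h | h | h | h
    · exact ⟨(0, (x - y) / 2, y), by simp [h4]; omega⟩
    · exact ⟨(1, -y + (1 - x + y) / 6, (1 - x + y) / 6), by simp [h4]; omega⟩
    · exact ⟨(2, y + (x - y + 1) / 6, (x - y + 1) / 6), by simp [h4]; omega⟩
    · exact ⟨(3, y + (x - y - 3) / 6, (x - y - 3) / 6), by simp [h4]; omega⟩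

noncomputable def F4 (q : ℝ) (p : ℤ × ℤ) : ℝ :=
  q ^ (p.1 ^ 2) * (-q ^ 5) ^ (p.2 ^ 2) - (-q) ^ (p.1 ^ 2) * (q ^ 5) ^ (p.2 ^ 2)

lemma F4_eq {q : ℝ} (h0 : q ≠ 0) (x y : ℤ) :
    F4 q (x, y) = ((-1) ^ y - (-1) ^ x) * q ^ (x ^ 2 + 5 * y ^ 2) := by
  unfold F4
  rw [neg_zpow_eq, neg_zpow_eq q, pm_sq, pm_sq, zpow_add₀ h0, zpow_mul]
  simp only [show q ^ (5 : ℤ) = q ^ 5 from by norm_cast]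
  ring

lemma I4 {q : ℝ} (h0 : q ≠ 0) (h1 : |q| < 1) :
    phi q * phi (-q ^ 5) - phi (-q) * phi (q ^ 5) = 4 * q * (ff (q ^ 4) * ff (q ^ 20)) := by
  have h4' := abs_pow_lt h1 (show 4 ≠ 0 by norm_num)
  have h5 := abs_pow_lt h1 (show 5 ≠ 0 by norm_num)
  have h20 := abs_pow_lt h1 (show 20 ≠ 0 by norm_num)
  have s1 := phi_summ h0 h1
  have s2 := phi_summ (neg_ne_zero.2 h0) (by rwa [abs_neg])
  have s3 := phi_summ (pow_ne_zero 5 h0) h5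
  have s4 := phi_summ (neg_ne_zero.2 (pow_ne_zero 5 h0)) (by rwa [abs_neg])
  rw [← pent (pow_ne_zero 4 h0) h4', ← pent (pow_ne_zero 20 h0) h20]
  have t1 := summ_th_norm (neg_ne_zero.2 (pow_ne_zero 4 h0)) (pow_ne_zero 3 (pow_ne_zero 4 h0))
    (abs_pow_lt h4' three_ne_zero)
  have t2 := summ_th_norm (neg_ne_zero.2 (pow_ne_zero 20 h0)) (pow_ne_zero 3 (pow_ne_zero 20 h0))
    (abs_pow_lt h20 three_ne_zero)
  unfold phi th
  have u1 := summable_mul_of_summable_norm s1 s4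
  have u2 := summable_mul_of_summable_norm s2 s3
  rw [prod_sum s1 s4, prod_sum s2 s3, prod_sum t1 t2, ← u1.tsum_sub u2]
  rw [show (∑' p : ℤ × ℤ, (q ^ p.1 ^ 2 * (-q ^ 5) ^ p.2 ^ 2 - (-q) ^ p.1 ^ 2 * (q ^ 5) ^ p.2 ^ 2))
    = ∑' p, F4 q p from rfl, tsum_classes h4 h4_bij (F4 q) (u1.sub u2), Fin.sum_univ_four]
  have c0 : ∀ p : ℤ × ℤ, F4 q (h4 0 p) = 0 := by
    rintro ⟨a, b⟩
    simp only [h4]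
    rw [F4_eq h0, pm_congr (2 * a + b) b a (by ring)]; ring
  have key : ∀ p : ℤ × ℤ, ∀ x y c d : ℤ, y = p.1 + p.2 + 2 * c → x = p.1 + p.2 + 1 + 2 * d →
      x ^ 2 + 5 * y ^ 2 = 1 + 6 * p.1 ^ 2 - 2 * p.1 + 5 * (6 * p.2 ^ 2 - 2 * p.2) →
      F4 q (x, y) = 2 * q ^ (1:ℤ) * ((-q ^ 4) ^ p.1 * ((q ^ 4) ^ 3) ^ (TT p.1) *
        ((-q ^ 20) ^ p.2 * ((q ^ 20) ^ 3) ^ (TT p.2))) := by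
    rintro ⟨a, b⟩ x y c d hy hx h
    simp only at hy hx h
    rw [F4_eq h0, pm_congr y (a + b) c hy, pm_congr x (a + b + 1) d hx, zpow_add_one₀ (by norm_num), h,
      neg_zpow_eq (q ^ 4), neg_zpow_eq (q ^ 20), zpow_add₀ (by norm_num)]
    have : q ^ (1 + 6 * a ^ 2 - 2 * a + 5 * (6 * b ^ 2 - 2 * b)) =
        q ^ (1:ℤ) * ((q ^ 4) ^ a * ((q ^ 4) ^ 3) ^ (TT a) * ((q ^ 20) ^ b * ((q ^ 20) ^ 3) ^ (TT b))) := by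
      simp only [← pow_mul, Nat.reduceMul]
      simp only [← zpow_natCast q, ← zpow_mul, ← zpow_add₀ h0]
      congr 1; push_cast
      linear_combination - 6 * two_TT a - 30 * two_TT b
    rw [this]; ring
  have c3 : ∑' p : ℤ × ℤ, F4 q (h4 3 p) = 0 := by
    have e := ((Equiv.subLeft (-1 : ℤ)).prodCongr (Equiv.refl ℤ)).tsum_eq (fun p => F4 q (h4 3 p))
    have : ∀ p : ℤ × ℤ, F4 q (h4 3 (((Equiv.subLeft (-1 : ℤ)).prodCongr (Equiv.refl ℤ)) p))
        = - F4 q (h4 3 p) := by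
      rintro ⟨a, b⟩
      simp only [h4, Equiv.prodCongr_apply, Prod.map, Equiv.subLeft_apply, Equiv.refl_apply]
      rw [F4_eq h0, F4_eq h0, pm_congr (-1 - a - b) (a + b + 1) (-1 - a - b) (by ring),
        pm_congr (-1 - a + 5 * b + 3) (a + b) (1 - a + 2 * b) (by ring),
        pm_congr (a - b) (a + b) (- b) (by ring),
        pm_congr (a + 5 * b + 3) (a + b + 1) (1 + 2 * b) (by ring),
        show (-1 - a + 5 * b + 3) ^ 2 + 5 * (-1 - a - b) ^ 2
          = (a + 5 * b + 3) ^ 2 + 5 * (a - b) ^ 2 by ring]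
      ring
    rw [tsum_congr this, tsum_neg] at e
    linarith
  rw [tsum_congr c0, tsum_zero, c3,
    tsum_congr fun p : ℤ × ℤ => key p (h4 1 p).1 (h4 1 p).2 (-p.1) (-p.1 - 3 * p.2)
      (by simp only [h4]; ring) (by simp only [h4]; ring) (by simp only [h4]; ring),
    tsum_congr fun p : ℤ × ℤ => key p (h4 2 p).1 (h4 2 p).2 (-p.2) (2 * p.2 - 1)
      (by simp only [h4]; ring) (by simp only [h4]; ring) (by simp only [h4]; ring),
    tsum_mul_left, zpow_one]
  ring

def h2 : Fin 2 → ℤ → ℤ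
  | 0, a => 2 * a
  | 1, a => 2 * a - 1

lemma h2_bij : Function.Bijective (fun p : Fin 2 × ℤ => h2 p.1 p.2) := by
  constructor
  · rintro ⟨i, a⟩ ⟨j, c⟩ h
    fin_cases i <;> fin_cases j <;> simp [h2] at h ⊢ <;> omega
  · intro x
    have : x % 2 = 0 ∨ x % 2 = 1 := by omega
    rcases this with h | h
    · exact ⟨(0, x / 2), by simp [h2]; omega⟩
    · exact ⟨(1, (x + 1) / 2), by simp [h2]; omega⟩

lemma S2 {q : ℝ} (h0 : q ≠ 0) (h1 : |q| < 1) : phi q = phi (q ^ 4) + q * Psi (q ^ 8) := by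
  unfold phi Psi
  rw [tsum_classes h2 h2_bij _ (phi_summ h0 h1).of_norm, Fin.sum_univ_two, ← tsum_mul_left]
  congr 1
  · refine tsum_congr fun n => ?_
    simp only [h2, ← zpow_natCast q, ← zpow_mul]
    congr 1; push_cast; ring
  · refine tsum_congr fun n => ?_
    have : q ^ (h2 1 n) ^ 2 = q ^ (1:ℤ) * (q ^ 8) ^ TT n := by
      simp only [h2, ← zpow_natCast q, ← zpow_mul, ← zpow_add₀ h0]
      congr 1; push_cast
      linear_combination - 4 * two_TT n
    rw [this, zpow_one]

lemma Psi_sq {q : ℝ} (h0 : q ≠ 0) (h1 : |q| < 1) : Psi q ^ 2 = 2 * phi q * Psi (q ^ 2) := by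
  have a := Psi_prod h0 h1
  have b := Psi_prod (pow_ne_zero 2 h0) (abs_pow_lt h1 two_ne_zero)
  have c := phi_prod h0 h1
  have n1 := ff_ne_zero h1
  have n2 := ff_ne_zero (abs_pow_lt h1 (show 2 ≠ 0 by norm_num))
  have n4 := ff_ne_zero (abs_pow_lt h1 (show 4 ≠ 0 by norm_num))
  rw [show (q ^ 2) ^ 2 = q ^ 4 by ring] at b
  rw [eq_div_of_mul_eq n1 a, eq_div_of_mul_eq n2 b, eq_div_of_mul_eq (pow_ne_zero 2 n1)
    (eq_div_of_mul_eq (pow_ne_zero 2 n4) c |>.symm ▸ rfl : phi q * ff q ^ 2 = ff (q ^ 2) ^ 5 / ff (q ^ 4) ^ 2)]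
  field_simp

lemma E1 {q : ℝ} (h0 : q ≠ 0) (h1 : |q| < 1) :
    (5 * phi (q ^ 5) ^ 2 - phi q ^ 2) * (ff (q ^ 5) * ff (q ^ 20))
      = 4 * ff q * ff (q ^ 4) * ff (q ^ 10) ^ 2 := by
  have h5 := abs_pow_lt h1 (show 5 ≠ 0 by norm_num)
  have h1' : |-q| < 1 := by rwa [abs_neg]
  have h0' : -q ≠ 0 := neg_ne_zero.2 h0
  have n5 : (-q) ^ 5 = - q ^ 5 := by ring
  have n10 : (-q) ^ 10 = q ^ 10 := by ring
  have p510 : (q ^ 5) ^ 2 = q ^ 10 := by ring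
  have p520 : (q ^ 5) ^ 4 = q ^ 20 := by ring
  have h5' : |-q ^ 5| < 1 := by rwa [abs_neg]
  have l1 := L1 h0 h1
  have r1 := R5a_prod h0 h1
  have l2 := L2 h0' h1'
  have r2 := R5b_prod h0' h1'
  have a1 := ff_neg h1
  have a5 := ff_neg h5
  have b1 := Psi_prod h0' h1'
  have b5 := Psi_prod (neg_ne_zero.2 (pow_ne_zero 5 h0)) h5'
  have c5 := phi_prod (pow_ne_zero 5 h0) h5
  have m1 := ff_ne_zero h1
  have m2 := ff_ne_zero (abs_pow_lt h1 (show 2 ≠ 0 by norm_num))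
  have m4 := ff_ne_zero (abs_pow_lt h1 (show 4 ≠ 0 by norm_num))
  have m5 := ff_ne_zero (abs_pow_lt h1 (show 5 ≠ 0 by norm_num))
  have m10 := ff_ne_zero (abs_pow_lt h1 (show 10 ≠ 0 by norm_num))
  have m20 := ff_ne_zero (abs_pow_lt h1 (show 20 ≠ 0 by norm_num))
  have m1' := ff_ne_zero h1'
  have m5' := ff_ne_zero h5'
  simp only [n5, n10, neg_sq, p510, p520] at l2 r2 a1 a5 b1 b5 c5
  generalize th q (q ^ 10) * th (q ^ 3) (q ^ 10) = T at *
  generalize th (-q) (-q ^ 5) * th (q ^ 2) (-q ^ 5) = S at *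
  generalize phi q = P1 at *
  generalize phi (q ^ 5) = P5 at *
  generalize Psi (-q) = Q1 at *
  generalize Psi (-q ^ 5) = Q5 at *
  generalize ff (-q) = g1 at *
  generalize ff (-q ^ 5) = g5 at *
  generalize ff q = f1 at *
  generalize ff (q ^ 2) = f2 at *
  generalize ff (q ^ 4) = f4 at *
  generalize ff (q ^ 5) = f5 at *
  generalize ff (q ^ 10) = f10 at *
  generalize ff (q ^ 20) = f20 at *
  have hT : T = f2 ^ 2 * f5 * f20 / (f1 * f4) := by field_simp; linear_combination r1
  have hg1 : g1 = f2 ^ 3 / (f1 * f4) := by field_simp; linear_combination a1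
  have hg5 : g5 = f10 ^ 3 / (f5 * f20) := by field_simp; linear_combination a5
  have hP5 : P5 = f10 ^ 5 / (f5 ^ 2 * f20 ^ 2) := by field_simp; linear_combination c5
  have hQ1 : Q1 = 2 * f2 ^ 2 / g1 := by field_simp; linear_combination b1
  have hQ5 : Q5 = 2 * f10 ^ 2 / g5 := by field_simp; linear_combination b5
  have hS : S = f2 * g5 ^ 3 / (g1 * f10) := by field_simp; linear_combination r2
  have hP1 : P1 ^ 2 = P5 ^ 2 + 4 * q * T := by linear_combination l1
  rw [hP1]
  rw [hQ1, hQ5, hS, hg1, hg5] at l2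
  rw [hT, hP5]
  clear hT hg1 hg5 hP5 hQ1 hQ5 hS hP1 r1 a1 a5 c5 b1 b5 r2 l1
  field_simp at l2 ⊢
  linear_combination -l2

lemma phi_pos {q : ℝ} (h0 : 0 < q) (h1 : q < 1) : 0 < phi q := by
  have h1' : |q| < 1 := by rwa [abs_of_pos h0]
  exact (phi_summ h0.ne' h1').of_norm.tsum_pos (fun n => (zpow_pos h0 _).le) 0 (zpow_pos h0 _)

lemma Psi_pos {q : ℝ} (h0 : 0 < q) (h1 : q < 1) : 0 < Psi q := by
  have h1' : |q| < 1 := by rwa [abs_of_pos h0]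
  exact (Psi_summ h0.ne' h1').of_norm.tsum_pos (fun n => (zpow_pos h0 _).le) 0 (zpow_pos h0 _)

lemma ff_pos {q : ℝ} (h0 : 0 < q) (h1 : q < 1) : 0 < ff q := by
  have h1' : |q| < 1 := by rwa [abs_of_pos h0]
  refine lt_of_le_of_ne ?_ (ff_ne_zero h1').symm
  refine ge_of_tendsto' (qp_tendsto q h1') fun N => Finset.prod_nonneg fun n _ => ?_
  rw [← pow_succ']
  have := pow_le_one₀ (n := n + 1) h0.le h1.le
  linarith

lemma theta_main {q : ℝ} (h0 : 0 < q) (h1 : q < 1) :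
    phi q ^ 2 * Psi (q ^ 5) + 2 * (Psi q * Psi (q ^ 4) * phi (q ^ 10))
      + 2 * (q ^ 2 * (Psi q * Psi (q ^ 20) * phi (q ^ 2)))
      - 2 * (q * (Psi q * Psi (q ^ 2) * Psi (q ^ 10))) = 5 * (Psi (q ^ 5) * phi (q ^ 5) ^ 2) := by
  have hq := h0.ne'
  have hq1 : |q| < 1 := by rwa [abs_of_pos h0]
  have ab : Psi (q ^ 4) * phi (q ^ 10) - q ^ 2 * Psi (q ^ 20) * phi (q ^ 2)
      = 2 * (ff (q ^ 2) * ff (q ^ 10)) := by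
    obtain ⟨r, hr0, hr⟩ : ∃ r : ℝ, 0 < r ∧ r ^ 2 = q := ⟨√q, Real.sqrt_pos.2 h0, Real.sq_sqrt h0.le⟩
    subst hr
    have hr1 : |r| < 1 := by
      rw [abs_of_pos hr0]; nlinarith
    have hr1' : |-r| < 1 := by rwa [abs_neg]
    have i := I4 hr0.ne' hr1
    have s1 := S2 hr0.ne' hr1
    have s2 := S2 (neg_ne_zero.2 hr0.ne') hr1'
    have s3 := S2 (pow_ne_zero 5 hr0.ne') (abs_pow_lt hr1 (show 5 ≠ 0 by norm_num))
    have s4 := S2 (neg_ne_zero.2 (pow_ne_zero 5 hr0.ne'))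
      (by rw [abs_neg]; exact (abs_pow_lt hr1 (show 5 ≠ 0 by norm_num)))
    simp only [(show Even 4 by decide).neg_pow, (show Even 8 by decide).neg_pow, ← pow_mul,
      Nat.reduceMul] at s1 s2 s3 s4 ⊢
    rw [s1, s2, s3, s4] at i
    apply mul_left_cancel₀ (mul_ne_zero two_ne_zero hr0.ne')
    linear_combination i
  have k : ∀ n : ℕ, n ≠ 0 → q ^ n ≠ 0 ∧ |q ^ n| < 1 := fun n hn =>
    ⟨pow_ne_zero n hq, abs_pow_lt hq1 hn⟩
  have sq2 := Psi_sq (k 2 (by norm_num)).1 (k 2 (by norm_num)).2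
  have sq10 := Psi_sq (k 10 (by norm_num)).1 (k 10 (by norm_num)).2
  have i := I4 hq hq1
  have e1 := E1 hq hq1
  have p1 := phi_prod hq hq1
  have p5 := phi_prod (k 5 (by norm_num)).1 (k 5 (by norm_num)).2
  have p1' := phi_neg_prod hq hq1
  have p5' := phi_neg_prod (k 5 (by norm_num)).1 (k 5 (by norm_num)).2
  have y1 := Psi_prod hq hq1
  have y5 := Psi_prod (k 5 (by norm_num)).1 (k 5 (by norm_num)).2
  have y2 := Psi_prod (k 2 (by norm_num)).1 (k 2 (by norm_num)).2
  have y10 := Psi_prod (k 10 (by norm_num)).1 (k 10 (by norm_num)).2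
  have m1 := ff_ne_zero hq1
  have m2 := ff_ne_zero (k 2 (by norm_num)).2
  have m4 := ff_ne_zero (k 4 (by norm_num)).2
  have m5 := ff_ne_zero (k 5 (by norm_num)).2
  have m10 := ff_ne_zero (k 10 (by norm_num)).2
  have m20 := ff_ne_zero (k 20 (by norm_num)).2
  simp only [← pow_mul, Nat.reduceMul] at sq2 sq10 p5 p5' y5 y2 y10
  have kk : ∀ n : ℕ, n ≠ 0 → 0 < q ^ n ∧ q ^ n < 1 := fun n hn =>
    ⟨pow_pos h0 n, pow_lt_one₀ h0.le h1 hn⟩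
  have z1 := phi_pos h0 h1
  have z5 := phi_pos (kk 5 (by norm_num)).1 (kk 5 (by norm_num)).2
  have z2 := phi_pos (kk 2 (by norm_num)).1 (kk 2 (by norm_num)).2
  have z10 := phi_pos (kk 10 (by norm_num)).1 (kk 10 (by norm_num)).2
  have w1 := Psi_pos h0 h1
  have w4 := Psi_pos (kk 4 (by norm_num)).1 (kk 4 (by norm_num)).2
  have w20 := Psi_pos (kk 20 (by norm_num)).1 (kk 20 (by norm_num)).2
  have g1 := ff_pos h0 h1
  have g2 := ff_pos (kk 2 (by norm_num)).1 (kk 2 (by norm_num)).2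
  have g4 := ff_pos (kk 4 (by norm_num)).1 (kk 4 (by norm_num)).2
  have g5 := ff_pos (kk 5 (by norm_num)).1 (kk 5 (by norm_num)).2
  have g10 := ff_pos (kk 10 (by norm_num)).1 (kk 10 (by norm_num)).2
  have g20 := ff_pos (kk 20 (by norm_num)).1 (kk 20 (by norm_num)).2
  generalize ff q = f1 at *
  generalize ff (q ^ 2) = f2 at *
  generalize ff (q ^ 4) = f4 at *
  generalize ff (q ^ 5) = f5 at *
  generalize ff (q ^ 10) = f10 at *
  generalize ff (q ^ 20) = f20 at *
  obtain ⟨α, hα⟩ : ∃ α, α = Psi (q ^ 4) * phi (q ^ 10) := ⟨_, rfl⟩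
  obtain ⟨β, hβ⟩ : ∃ β, β = q ^ 2 * Psi (q ^ 20) * phi (q ^ 2) := ⟨_, rfl⟩
  have hαp : 0 < α := by rw [hα]; positivity
  have hβp : 0 < β := by rw [hβ]; positivity
  have hY2 : Psi (q ^ 2) = 2 * f4 ^ 2 / f2 := by field_simp; linear_combination y2
  have hY10 : Psi (q ^ 10) = 2 * f20 ^ 2 / f10 := by field_simp; linear_combination y10
  have hY1 : Psi q = 2 * f2 ^ 2 / f1 := by field_simp; linear_combination y1
  have hY5 : Psi (q ^ 5) = 2 * f10 ^ 2 / f5 := by field_simp; linear_combination y5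
  have hP1 : phi q = f2 ^ 5 / (f1 ^ 2 * f4 ^ 2) := by field_simp; linear_combination p1
  have hP5 : phi (q ^ 5) = f10 ^ 5 / (f5 ^ 2 * f20 ^ 2) := by field_simp; linear_combination p5
  have hP1' : phi (-q) = f1 ^ 2 / f2 := by field_simp; linear_combination p1'
  have hP5' : phi (-q ^ 5) = f5 ^ 2 / f10 := by field_simp; linear_combination p5'
  have hE : 5 * phi (q ^ 5) ^ 2 - phi q ^ 2 = 4 * f1 * f4 * f10 ^ 2 / (f5 * f20) := by
    field_simp; linear_combination e1
  obtain ⟨U, hU⟩ : ∃ U, U = f2 ^ 4 * f5 ^ 2 * f20 / (f1 ^ 2 * f4 * f10 ^ 2) := ⟨_, rfl⟩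
  obtain ⟨V, hV⟩ : ∃ V, V = f1 ^ 2 * f4 * f10 ^ 4 / (f2 ^ 2 * f5 ^ 2 * f20) := ⟨_, rfl⟩
  have hUp : 0 < U := by rw [hU]; positivity
  have hVp : 0 < V := by rw [hV]; positivity
  have hUV : U * V = f2 ^ 2 * f10 ^ 2 := by rw [hU, hV]; field_simp
  have hd : U - V = q * Psi (q ^ 2) * Psi (q ^ 10) := by
    have : U - V = (phi q * phi (-q ^ 5) - phi (-q) * phi (q ^ 5)) * (f4 * f20 / (f2 * f10)) := by
      rw [hU, hV, hP1, hP5, hP1', hP5']; field_simp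
    rw [this, i, hY2, hY10]; field_simp; ring
  have hab : 4 * (α * β) = (U - V) ^ 2 := by
    rw [hd, hα, hβ]
    linear_combination (-q ^ 2 * Psi (q ^ 10) ^ 2) * sq2
      - (q ^ 2 * 2 * phi (q ^ 2) * Psi (q ^ 4)) * sq10
  have hs : α + β = U + V := by
    have : (α + β) ^ 2 = (U + V) ^ 2 := by
      rw [← hα, ← hβ] at ab
      linear_combination hab + (α - β + 2 * (f2 * f10)) * ab - 4 * hUV
    exact (pow_left_inj₀ (by positivity) (by positivity) two_ne_zero).1 this
  have h3 : α + β - q * Psi (q ^ 2) * Psi (q ^ 10) = 2 * V := by rw [← hd, hs]; ring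
  have h6 : (5 * phi (q ^ 5) ^ 2 - phi q ^ 2) * Psi (q ^ 5) = 4 * Psi q * V := by
    rw [hE, hY5, hY1, hV]; field_simp
  rw [hα, hβ] at h3
  linear_combination 2 * Psi q * h3 - h6

def fib (g : ℤ × ℤ × ℤ → ℤ) (n : ℕ) : Set (ℤ × ℤ × ℤ) := {p | g p = n}

lemma fib_hasSum {g : ℤ × ℤ × ℤ → ℤ} (hg : ∀ p, 0 ≤ g p) {q s : ℝ} (h0 : 0 < q)
    (hs : HasSum (fun p => q ^ g p) s) :
    (∀ n, (fib g n).Finite) ∧ HasSum (fun n : ℕ => ((fib g n).ncard : ℝ) * q ^ n) s := by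
  have hfin : ∀ n, (fib g n).Finite := by
    intro n
    by_contra hinf
    have : Infinite (fib g n) := Set.infinite_coe_iff.2 hinf
    have h2 : Summable (fun p : fib g n => q ^ g p) := hs.summable.subtype _
    have h3 : (fun p : fib g n => q ^ g p) = fun _ => q ^ (n : ℤ) := by
      funext p
      rw [show g p = n from p.2]
    rw [h3, summable_const_iff] at h2
    exact (zpow_pos h0 _).ne' h2
  refine ⟨hfin, ?_⟩
  let e := Equiv.sigmaFiberEquiv (fun p => (g p).toNat)
  have h1 : HasSum ((fun p => q ^ g p) ∘ e) s := e.hasSum_iff.2 hs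
  refine h1.sigma fun n => ?_
  have hfib : {p | (g p).toNat = n} = fib g n := by
    ext p
    have := hg p
    simp only [fib, Set.mem_ofPred_eq]
    omega
  have h4 : (fun c : {p // (g p).toNat = n} => ((fun p => q ^ g p) ∘ e) ⟨n, c⟩) = fun _ => q ^ n := by
    funext c
    have h5 : g c.1 = n := by
      have := c.2
      have := hg c.1
      omega
    simp only [Function.comp, e, Equiv.sigmaFiberEquiv, Equiv.coe_fn_mk]
    rw [h5, zpow_natCast]
  rw [h4]
  have : Finite {p // (g p).toNat = n} := by
    have := hfin n
    rw [← hfib] at this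
    exact this
  have : Fintype {p // (g p).toNat = n} := Fintype.ofFinite _
  have h6 := hasSum_fintype (fun _ : {p // (g p).toNat = n} => q ^ n)
  rw [Finset.sum_const, Finset.card_univ, nsmul_eq_mul, ← Nat.card_eq_fintype_card] at h6
  rw [← hfib]
  exact h6

lemma fib3 {f g h : ℤ → ℤ} (hf : ∀ n, 0 ≤ f n) (hg : ∀ n, 0 ≤ g n) (hh : ∀ n, 0 ≤ h n) (c : ℕ)
    {q : ℝ} (h0 : 0 < q) (sf : Summable fun n => ‖q ^ f n‖) (sg : Summable fun n => ‖q ^ g n‖)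
    (sh : Summable fun n => ‖q ^ h n‖) :
    (∀ n, (fib (fun p => c + f p.1 + g p.2.1 + h p.2.2) n).Finite) ∧
    HasSum (fun n : ℕ => ((fib (fun p => c + f p.1 + g p.2.1 + h p.2.2) n).ncard : ℝ) * q ^ n)
      (q ^ c * ((∑' n, q ^ f n) * (∑' n, q ^ g n) * (∑' n, q ^ h n))) := by
  apply fib_hasSum
  · intro p
    have := hf p.1
    have := hg p.2.1
    have := hh p.2.2
    positivity
  · exact h0
  · have s1 := sg.mul_norm sh
    have s2 : HasSum (fun p : ℤ × ℤ × ℤ => q ^ f p.1 * (q ^ g p.2.1 * q ^ h p.2.2))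
        ((∑' n, q ^ f n) * ((∑' n, q ^ g n) * (∑' n, q ^ h n))) := by
      rw [tsum_mul_tsum_of_summable_norm sg sh, tsum_mul_tsum_of_summable_norm sf s1]
      exact (summable_mul_of_summable_norm sf s1).hasSum
    have s3 := s2.mul_left (q ^ c)
    rw [← mul_assoc (∑' n, q ^ f n)] at s3
    have e : (fun p : ℤ × ℤ × ℤ => q ^ ((c : ℤ) + f p.1 + g p.2.1 + h p.2.2))
        = fun i => q ^ c * (q ^ f i.1 * (q ^ g i.2.1 * q ^ h i.2.2)) := by
      funext p
      rw [zpow_add₀ h0.ne', zpow_add₀ h0.ne', zpow_add₀ h0.ne', zpow_natCast]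
      ring
    rw [e]
    exact s3

lemma uniq (a : ℕ → ℝ) (ha : ∀ q : ℝ, 0 < q → q < 1 → HasSum (fun n => a n * q ^ n) 0) (n : ℕ) :
    a n = 0 := by
  induction n using Nat.strong_induction_on with
  | _ n ih =>
  have hsum : Summable fun m => |a (m + (n + 1))| * (1 / 2 : ℝ) ^ m := by
    have h := (ha (1 / 2) (by norm_num) (by norm_num)).summable.norm
    have h := ((summable_nat_add_iff (n + 1)).2 h).mul_left ((2 : ℝ) ^ (n + 1))
    refine h.congr fun m => ?_
    have e : (2 : ℝ) ^ (n + 1) * (1 / 2) ^ (n + 1) = 1 := by rw [← mul_pow]; norm_num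
    rw [norm_mul, Real.norm_eq_abs, norm_pow, Real.norm_of_nonneg (by norm_num : (0 : ℝ) ≤ 1 / 2),
      pow_add _ m (n + 1)]
    linear_combination (|a (m + (n + 1))| * (1 / 2) ^ m) * e
  obtain ⟨C, hC⟩ : ∃ C, C = ∑' m, |a (m + (n + 1))| * (1 / 2 : ℝ) ^ m := ⟨_, rfl⟩
  have key : ∀ q : ℝ, 0 < q → q ≤ 1 / 2 → |a n| ≤ q * C := by
    intro q h0 h1
    have h := (hasSum_nat_add_iff' (n + 1)).2 (ha q h0 (by linarith))
    rw [Finset.sum_range_succ, Finset.sum_eq_zero (fun i hi => by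
      rw [ih i (Finset.mem_range.1 hi), zero_mul]), zero_add, zero_sub] at h
    have hb : ∀ m, |a (m + (n + 1)) * q ^ (m + (n + 1))|
        ≤ q ^ (n + 1) * (|a (m + (n + 1))| * (1 / 2 : ℝ) ^ m) := by
      intro m
      rw [abs_mul, abs_of_pos (pow_pos h0 _), pow_add]
      have := pow_le_pow_left₀ h0.le h1 m
      calc _ = (|a (m + (n + 1))| * q ^ (n + 1)) * q ^ m := by ring
        _ ≤ (|a (m + (n + 1))| * q ^ (n + 1)) * (1 / 2) ^ m := by gcongr
        _ = _ := by ring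
    have h2 : |-(a n * q ^ n)| ≤ q ^ (n + 1) * C := by
      have h3 := tsum_of_norm_bounded (f := fun m => a (m + (n + 1)) * q ^ (m + (n + 1)))
        (hsum.mul_left (q ^ (n + 1))).hasSum hb
      rw [h.tsum_eq, tsum_mul_left, ← hC] at h3
      exact h3
    rw [abs_neg, abs_mul, abs_of_pos (pow_pos h0 n), pow_succ] at h2
    have := pow_pos h0 n
    refine le_of_mul_le_mul_right (a := q ^ n) ?_ this
    linarith
  have lim : Tendsto (fun q : ℝ => q * C) (𝓝[>] 0) (𝓝 0) := by
    have : Tendsto (fun q : ℝ => q * C) (𝓝 0) (𝓝 (0 * C)) := tendsto_id.mul_const C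
    rw [zero_mul] at this
    exact this.mono_left nhdsWithin_le_nhds
  have hev : ∀ᶠ q : ℝ in 𝓝[>] 0, |a n| ≤ q * C := by
    filter_upwards [Ioc_mem_nhdsGT (show (0 : ℝ) < 1 / 2 by norm_num)] with q hq
    exact key q hq.1 hq.2
  exact abs_eq_zero.1 (le_antisymm (ge_of_tendsto lim hev) (abs_nonneg _))

def G1 : ℤ × ℤ × ℤ → ℤ := fun p => (0 : ℕ) + p.1 ^ 2 + p.2.1 ^ 2 + 5 * TT p.2.2
def G2 : ℤ × ℤ × ℤ → ℤ := fun p => (0 : ℕ) + TT p.1 + 4 * TT p.2.1 + 10 * p.2.2 ^ 2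
def G3 : ℤ × ℤ × ℤ → ℤ := fun p => (2 : ℕ) + TT p.1 + 20 * TT p.2.1 + 2 * p.2.2 ^ 2
def G4 : ℤ × ℤ × ℤ → ℤ := fun p => (1 : ℕ) + TT p.1 + 2 * TT p.2.1 + 10 * TT p.2.2
def G5 : ℤ × ℤ × ℤ → ℤ := fun p => (0 : ℕ) + 5 * TT p.1 + 5 * p.2.1 ^ 2 + 5 * p.2.2 ^ 2

lemma sT {q : ℝ} (h0 : 0 < q) (h1 : q < 1) (k : ℕ) (hk : k ≠ 0) :
    (Summable fun n : ℤ => ‖q ^ ((k : ℤ) * TT n)‖) ∧ ∑' n : ℤ, q ^ ((k : ℤ) * TT n) = Psi (q ^ k) := by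
  have := Psi_summ (pow_ne_zero k h0.ne') (abs_pow_lt (by rwa [abs_of_pos h0]) hk)
  simp only [← zpow_natCast q, ← zpow_mul] at this
  refine ⟨this, ?_⟩
  unfold Psi
  simp only [← zpow_natCast q, ← zpow_mul]

lemma sP {q : ℝ} (h0 : 0 < q) (h1 : q < 1) (k : ℕ) (hk : k ≠ 0) :
    (Summable fun n : ℤ => ‖q ^ ((k : ℤ) * n ^ 2)‖) ∧ ∑' n : ℤ, q ^ ((k : ℤ) * n ^ 2) = phi (q ^ k) := by
  have := phi_summ (pow_ne_zero k h0.ne') (abs_pow_lt (by rwa [abs_of_pos h0]) hk)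
  simp only [← zpow_natCast q, ← zpow_mul] at this
  refine ⟨this, ?_⟩
  unfold phi
  simp only [← zpow_natCast q, ← zpow_mul]

lemma nT (k : ℕ) (n : ℤ) : 0 ≤ (k : ℤ) * TT n := mul_nonneg (by positivity) (TT_nonneg n)
lemma nP (k : ℕ) (n : ℤ) : 0 ≤ (k : ℤ) * n ^ 2 := by positivity

lemma H1 {q : ℝ} (h0 : 0 < q) (h1 : q < 1) :
    HasSum (fun n : ℕ => ((fib G1 n).ncard : ℝ) * q ^ n) (phi q ^ 2 * Psi (q ^ 5)) := by
  have a := sP h0 h1 1 (by norm_num)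
  have b := sT h0 h1 5 (by norm_num)
  have := (fib3 (nP 1) (nP 1) (nT 5) 0 h0 a.1 a.1 b.1).2
  rw [a.2, b.2] at this
  have e : G1 = fun p => ((0 : ℕ) : ℤ) + ((1 : ℕ) : ℤ) * p.1 ^ 2 + ((1 : ℕ) : ℤ) * p.2.1 ^ 2 + ((5 : ℕ) : ℤ) * TT p.2.2 := by
    funext p; simp [G1]
  rw [e]
  rw [pow_two (phi q)]
  simpa only [pow_zero, pow_one, one_mul, ← mul_assoc] using this

lemma H2 {q : ℝ} (h0 : 0 < q) (h1 : q < 1) : (∀ n, (fib G2 n).Finite) ∧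
    HasSum (fun n : ℕ => ((fib G2 n).ncard : ℝ) * q ^ n) (Psi q * Psi (q ^ 4) * phi (q ^ 10)) := by
  have a := sT h0 h1 1 (by norm_num)
  have b := sT h0 h1 4 (by norm_num)
  have c := sP h0 h1 10 (by norm_num)
  have := (fib3 (nT 1) (nT 4) (nP 10) 0 h0 a.1 b.1 c.1)
  rw [a.2, b.2, c.2] at this
  have e : G2 = fun p => ((0 : ℕ) : ℤ) + ((1 : ℕ) : ℤ) * TT p.1 + ((4 : ℕ) : ℤ) * TT p.2.1 + ((10 : ℕ) : ℤ) * p.2.2 ^ 2 := by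
    funext p; simp [G2]
  rw [e]
  simpa only [pow_zero, pow_one, one_mul, ← mul_assoc] using this

lemma H3 {q : ℝ} (h0 : 0 < q) (h1 : q < 1) : (∀ n, (fib G3 n).Finite) ∧
    HasSum (fun n : ℕ => ((fib G3 n).ncard : ℝ) * q ^ n)
      (q ^ 2 * (Psi q * Psi (q ^ 20) * phi (q ^ 2))) := by
  have a := sT h0 h1 1 (by norm_num)
  have b := sT h0 h1 20 (by norm_num)
  have c := sP h0 h1 2 (by norm_num)
  have := (fib3 (nT 1) (nT 20) (nP 2) 2 h0 a.1 b.1 c.1)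
  rw [a.2, b.2, c.2] at this
  have e : G3 = fun p => ((2 : ℕ) : ℤ) + ((1 : ℕ) : ℤ) * TT p.1 + ((20 : ℕ) : ℤ) * TT p.2.1 + ((2 : ℕ) : ℤ) * p.2.2 ^ 2 := by
    funext p; simp [G3]
  rw [e]
  simpa only [pow_zero, pow_one, one_mul, ← mul_assoc] using this

lemma H4 {q : ℝ} (h0 : 0 < q) (h1 : q < 1) :
    HasSum (fun n : ℕ => ((fib G4 n).ncard : ℝ) * q ^ n)
      (q * (Psi q * Psi (q ^ 2) * Psi (q ^ 10))) := by
  have a := sT h0 h1 1 (by norm_num)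
  have b := sT h0 h1 2 (by norm_num)
  have c := sT h0 h1 10 (by norm_num)
  have := (fib3 (nT 1) (nT 2) (nT 10) 1 h0 a.1 b.1 c.1).2
  rw [a.2, b.2, c.2] at this
  have e : G4 = fun p => ((1 : ℕ) : ℤ) + ((1 : ℕ) : ℤ) * TT p.1 + ((2 : ℕ) : ℤ) * TT p.2.1 + ((10 : ℕ) : ℤ) * TT p.2.2 := by
    funext p; simp [G4]
  rw [e]
  simpa only [pow_zero, pow_one, one_mul, ← mul_assoc] using this

lemma H5 {q : ℝ} (h0 : 0 < q) (h1 : q < 1) :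
    HasSum (fun n : ℕ => ((fib G5 n).ncard : ℝ) * q ^ n) (Psi (q ^ 5) * phi (q ^ 5) ^ 2) := by
  have a := sT h0 h1 5 (by norm_num)
  have b := sP h0 h1 5 (by norm_num)
  have := (fib3 (nT 5) (nP 5) (nP 5) 0 h0 a.1 b.1 b.1).2
  rw [a.2, b.2] at this
  have e : G5 = fun p => ((0 : ℕ) : ℤ) + ((5 : ℕ) : ℤ) * TT p.1 + ((5 : ℕ) : ℤ) * p.2.1 ^ 2 + ((5 : ℕ) : ℤ) * p.2.2 ^ 2 := by
    funext p; simp [G5]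
  rw [e]
  rw [pow_two (phi (q ^ 5))]
  simpa only [pow_zero, pow_one, one_mul, ← mul_assoc] using this

lemma count_id (n : ℕ) : 5 * ((fib G5 n).ncard : ℤ) = (fib G1 n).ncard
    + 2 * ((fib G2 n).ncard + (fib G3 n).ncard) - 2 * (fib G4 n).ncard := by
  have := uniq (fun n => ((fib G1 n).ncard : ℝ) + 2 * (fib G2 n).ncard + 2 * (fib G3 n).ncard
    - 2 * (fib G4 n).ncard - 5 * (fib G5 n).ncard) (fun q h0 h1 => by
      have h := ((((H1 h0 h1).add ((H2 h0 h1).2.mul_left 2)).add ((H3 h0 h1).2.mul_left 2)).sub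
        ((H4 h0 h1).mul_left 2)).sub ((H5 h0 h1).mul_left 5)
      rw [theta_main h0 h1, sub_self] at h
      refine h.congr_fun ?_
      intro m
      ring) n
  have h2 : (5 * ((fib G5 n).ncard : ℝ)) = (fib G1 n).ncard
    + 2 * ((fib G2 n).ncard + (fib G3 n).ncard) - 2 * (fib G4 n).ncard := by linarith
  exact_mod_cast h2

lemma odd_sq (k : ℤ) : (2 * k - 1) ^ 2 = 8 * TT k + 1 := by
  linear_combination -4 * two_TT k

lemma five_dvd {x : ℤ} (k : ℤ) (h : x ^ 2 = 5 * k) : ∃ u, x = 5 * u :=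
  (Int.prime_iff_natAbs_prime.2 (by norm_num)).dvd_of_dvd_pow ⟨k, h⟩

lemma odd_form {x : ℤ} (h : x % 2 = 1) : ∃ k, x = 2 * k - 1 := ⟨(x + 1) / 2, by omega⟩

lemma even_form {x : ℤ} (h : x % 2 = 0) : ∃ k, x = 2 * k := ⟨x / 2, by omega⟩

/-- parity data for a square -/
lemma sq_cases (x : ℤ) : (∃ k, x = 2 * k ∧ x ^ 2 = 4 * k ^ 2) ∨
    (∃ k, x = 2 * k - 1 ∧ x ^ 2 = 8 * TT k + 1) := by
  rcases Int.emod_two_eq_zero_or_one x with h | h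
  · obtain ⟨k, rfl⟩ := even_form h
    exact Or.inl ⟨k, rfl, by ring⟩
  · obtain ⟨k, rfl⟩ := odd_form h
    exact Or.inr ⟨k, rfl, odd_sq k⟩

lemma c1 (n : ℕ) : rep 1 10 10 0 0 0 (40 * n + 25) = (fib G1 n).ncard := by
  have inj : Function.Injective (fun p : ℤ × ℤ × ℤ => ((5 * (2 * p.2.2 - 1), 2 * p.1, 2 * p.2.1) : ℤ × ℤ × ℤ)) := by
    rintro ⟨a, b, c⟩ ⟨d, e, f⟩ h
    simp only [Prod.mk.injEq] at h ⊢
    omega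
  rw [← Set.ncard_image_of_injective _ inj]
  unfold rep
  congr 1
  ext ⟨x, y, z⟩
  simp only [fib, G1, Set.mem_ofPred_eq, Set.mem_image, Prod.exists, Prod.mk.injEq, Nat.cast_zero]
  constructor
  · intro h
    obtain ⟨u, rfl⟩ := five_dvd (x := x) (8 * n + 5 - 2 * y ^ 2 - 2 * z ^ 2) (by linarith)
    have h' : 5 * u ^ 2 + 2 * y ^ 2 + 2 * z ^ 2 = 8 * n + 5 := by nlinarith
    rcases sq_cases u with ⟨k, hk, hk'⟩ | ⟨k, hk, hk'⟩ <;>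
    rcases sq_cases y with ⟨l, hl, hl'⟩ | ⟨l, hl, hl'⟩ <;>
    rcases sq_cases z with ⟨m, hm, hm'⟩ | ⟨m, hm, hm'⟩ <;> first | omega | skip
    exact ⟨l, m, k, by omega, by rw [hk], hl.symm, hm.symm⟩
  · rintro ⟨a, b, c, h, rfl, rfl, rfl⟩
    linear_combination 25 * (-odd_sq c) - 40 * h

lemma c4 (n : ℕ) : rep 2 5 10 0 0 0 (40 * n + 25) = (fib G4 n).ncard := by
  have inj : Function.Injective (fun p : ℤ × ℤ × ℤ =>
      ((5 * (2 * p.2.2 - 1), 2 * p.1 - 1, 2 * p.2.1 - 1) : ℤ × ℤ × ℤ)) := by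
    rintro ⟨a, b, c⟩ ⟨d, e, f⟩ h
    simp only [Prod.mk.injEq] at h ⊢
    omega
  rw [← Set.ncard_image_of_injective _ inj]
  unfold rep
  congr 1
  ext ⟨x, y, z⟩
  simp only [fib, G4, Set.mem_ofPred_eq, Set.mem_image, Prod.exists, Prod.mk.injEq, Nat.cast_one]
  constructor
  · intro h
    obtain ⟨u, rfl⟩ : ∃ u, x = 5 * u :=
      five_dvd (3 * (8 * n + 5 - y ^ 2 - 2 * z ^ 2) - x ^ 2) (by linarith)
    have h' : 10 * u ^ 2 + y ^ 2 + 2 * z ^ 2 = 8 * n + 5 := by nlinarith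
    rcases sq_cases u with ⟨k, hk, hk'⟩ | ⟨k, hk, hk'⟩ <;>
    rcases sq_cases y with ⟨l, hl, hl'⟩ | ⟨l, hl, hl'⟩ <;>
    rcases sq_cases z with ⟨m, hm, hm'⟩ | ⟨m, hm, hm'⟩ <;> first | omega | skip
    exact ⟨l, m, k, by omega, by rw [hk], hl.symm, hm.symm⟩
  · rintro ⟨a, b, c, h, rfl, rfl, rfl⟩
    linear_combination 50 * (-odd_sq c) - 5 * odd_sq a - 10 * odd_sq b - 40 * h

lemma c5 (m : ℕ) : rep 1 8 8 0 0 0 (8 * m + 1) = (fib G5 (5 * m)).ncard := by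
  have inj : Function.Injective (fun p : ℤ × ℤ × ℤ =>
      ((2 * p.1 - 1, p.2.1, p.2.2) : ℤ × ℤ × ℤ)) := by
    rintro ⟨a, b, c⟩ ⟨d, e, f⟩ h
    simp only [Prod.mk.injEq] at h ⊢
    omega
  rw [← Set.ncard_image_of_injective _ inj]
  unfold rep
  congr 1
  ext ⟨x, y, z⟩
  simp only [fib, G5, Set.mem_ofPred_eq, Set.mem_image, Prod.exists, Prod.mk.injEq, Nat.cast_zero]
  push_cast
  constructor
  · intro h
    rcases sq_cases x with ⟨k, hk, hk'⟩ | ⟨k, hk, hk'⟩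
    · exfalso
      rw [hk'] at h
      generalize y ^ 2 = Y at *
      generalize z ^ 2 = Z at *
      ring_nf at h
      omega
    · exact ⟨k, by linarith, by simp [hk]⟩
  · rintro ⟨a, h, rfl, -⟩
    rw [odd_sq]
    linarith

lemma c5' (n : ℕ) (h : ¬ 5 ∣ n) : (fib G5 n).ncard = 0 := by
  have : fib G5 n = ∅ := by
    ext p
    simp only [fib, G5, Set.mem_ofPred_eq, Set.mem_empty_iff_false, iff_false, Nat.cast_zero]
    intro h'
    omega
  rw [this, Set.ncard_empty]

lemma c23 (n : ℕ) : rep 4 5 6 0 4 0 (40 * n + 25) = (fib G2 n).ncard + (fib G3 n).ncard := by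
  have inj2 : Function.Injective (fun p : ℤ × ℤ × ℤ =>
      ((10 * p.2.2 - (2 * p.2.1 - 1), 2 * p.1 - 1, 2 * (2 * p.2.1 - 1)) : ℤ × ℤ × ℤ)) := by
    rintro ⟨a, b, c⟩ ⟨d, e, f⟩ h
    simp only [Prod.mk.injEq] at h ⊢
    omega
  have inj3 : Function.Injective (fun p : ℤ × ℤ × ℤ =>
      ((5 * (2 * p.2.1 - 1) - 2 * p.2.2, 2 * p.1 - 1, 4 * p.2.2) : ℤ × ℤ × ℤ)) := by
    rintro ⟨a, b, c⟩ ⟨d, e, f⟩ h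
    simp only [Prod.mk.injEq] at h ⊢
    omega
  have f2 := (H2 (q := 1 / 2) (by norm_num) (by norm_num)).1 n
  have f3 := (H3 (q := 1 / 2) (by norm_num) (by norm_num)).1 n
  rw [← Set.ncard_image_of_injective (fib G2 n) inj2, ← Set.ncard_image_of_injective (fib G3 n) inj3,
    ← Set.ncard_union_eq ?_ (f2.image _) (f3.image _)]
  · unfold rep
    congr 1
    ext ⟨x, y, z⟩
    simp only [fib, G2, G3, Set.mem_ofPred_eq, Set.mem_union, Set.mem_image, Prod.exists, Prod.mk.injEq,
      Nat.cast_zero]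
    push_cast
    constructor
    · intro h
      rcases sq_cases y with ⟨l, hl, hl'⟩ | ⟨l, hl, hl'⟩
      · exfalso
        rw [hl'] at h
        ring_nf at h
        omega
      have hz : ∃ w, z = 2 * w := by
        rcases sq_cases z with ⟨m, hm, hm'⟩ | ⟨m, hm, hm'⟩
        · exact ⟨m, hm⟩
        · exfalso
          rw [hl', hm'] at h
          ring_nf at h
          omega
      obtain ⟨w, rfl⟩ := hz
      rw [hl'] at h
      have h1 : (x + w) ^ 2 + 5 * w ^ 2 = 10 * (n - TT l) + 5 := by nlinarith
      obtain ⟨v, hv⟩ := five_dvd (x := x + w) (2 * (n - TT l) + 1 - w ^ 2) (by linarith)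
      have h2 : 5 * v ^ 2 + w ^ 2 = 2 * (n - TT l) + 1 := by rw [hv] at h1; nlinarith
      rcases sq_cases v with ⟨k, hk, hk'⟩ | ⟨k, hk, hk'⟩ <;>
      rcases sq_cases w with ⟨m, hm, hm'⟩ | ⟨m, hm, hm'⟩
      · omega
      · exact Or.inl ⟨l, m, k, by omega, by omega, by omega, by omega⟩
      · exact Or.inr ⟨l, k, m, by omega, by omega, by omega, by omega⟩
      · omega
    · rintro (⟨a, b, c, h, rfl, rfl, rfl⟩ | ⟨a, b, c, h, rfl, rfl, rfl⟩)
      · linear_combination -40 * h - 5 * odd_sq a - 20 * odd_sq b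
      · linear_combination -40 * h - 5 * odd_sq a - 100 * odd_sq b
  · rw [Set.disjoint_left]
    rintro p ⟨⟨a, b, c⟩, -, rfl⟩ ⟨⟨d, e, f⟩, -, h⟩
    simp only [Prod.mk.injEq] at h
    omega

theorem disc400_companion (M : ℤ) (hM : 0 < M) (h8 : M % 8 = 1) (h5 : 5 ∣ M) :
    5 * (if (5 ^ 2 : ℤ) ∣ M then (rep 1 8 8 0 0 0 (M / 5 ^ 2) : ℤ) else 0) =
      (rep 1 10 10 0 0 0 M : ℤ) + 2 * rep 4 5 6 0 4 0 M - 2 * rep 2 5 10 0 0 0 M := by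
  obtain ⟨n, rfl⟩ : ∃ n : ℕ, M = 40 * n + 25 := ⟨(M / 40).toNat, by omega⟩
  rw [c1, c4, c23]
  have := count_id n
  push_cast
  rw [← this]
  congr 1
  split_ifs with h
  · obtain ⟨m, rfl⟩ : ∃ m : ℕ, n = 5 * m := ⟨n / 5, by omega⟩
    rw [← c5]
    congr 2
    push_cast
    omega
  · rw [c5' n (by omega)]
    rfl
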